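/- arXiv:1709.09045 — 2 statements merged into one kernel-verified Lean document; each statement's English description precedes it below -/
import Mathlib

section
/- Let f be a smooth function on an open neighborhood U of 0 in ℝⁿ and let N ∈ ℕ, N ≥ 1. Then f(x) = Σ_{α : ⟨α⟩ < N} (1/α!) ∂^α f(0) x^α + R_N(x) on U, where R_N is a smooth function on U of weight ≥ N which can be written as R_N(x) = Σ_{α : |α| ≤ N ≤ ⟨α⟩} x^α R_{Nα}(x) for some smooth functions R_{Nα} on U. -/
open scoped BigOperators
open Filter Topology

namespace Carnot

/-- Anisotropic dilation `t · x = (t^{w_1} x_1, …, t^{w_n} x_n)`. -/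
def dil {n : ℕ} (w : Fin n → ℕ) (t : ℝ) (x : Fin n → ℝ) : Fin n → ℝ :=
  fun i => t ^ (w i) * x i

/-- Weighted length `⟨α⟩` of a multi-index. -/
def wlen {n : ℕ} (w : Fin n → ℕ) (α : Fin n → ℕ) : ℕ := ∑ i, w i * α i

/-- Length `|α|` of a multi-index. -/
def mlen {n : ℕ} (α : Fin n → ℕ) : ℕ := ∑ i, α i

/-- A vector field acting on a function: `(Xf)(x) = Df(x)[X(x)]`. -/
noncomputable def vf {n : ℕ} (X : (Fin n → ℝ) → (Fin n → ℝ)) (f : (Fin n → ℝ) → ℝ) :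
    (Fin n → ℝ) → ℝ :=
  fun x => fderiv ℝ f x (X x)

/-- Iterated action `X_I f = X_{i_1}(X_{i_2}(⋯(X_{i_k} f)))`. -/
noncomputable def vfSeq {n : ℕ} (X : Fin n → (Fin n → ℝ) → (Fin n → ℝ)) :
    List (Fin n) → ((Fin n → ℝ) → ℝ) → ((Fin n → ℝ) → ℝ)
  | [], f => f
  | i :: I, f => vf (X i) (vfSeq X I f)

/-- Weight `⟨I⟩` of a finite sequence of indices. -/
def seqW {n : ℕ} (w : Fin n → ℕ) (I : List (Fin n)) : ℕ := (I.map w).sum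

/-- The list `(1,…,1,2,…,2,…,n,…,n)` with `i` repeated `α i` times. -/
def multiList {n : ℕ} (α : Fin n → ℕ) : List (Fin n) :=
  (List.finRange n).flatMap fun i => List.replicate (α i) i

/-- `X^α f = X_1^{α_1} ⋯ X_n^{α_n} f`. -/
noncomputable def vfPow {n : ℕ} (X : Fin n → (Fin n → ℝ) → (Fin n → ℝ)) (α : Fin n → ℕ)
    (f : (Fin n → ℝ) → ℝ) : (Fin n → ℝ) → ℝ :=
  vfSeq X (multiList α) f

/-- Partial derivative `∂^α f`. -/
noncomputable def pdPow {n : ℕ} (α : Fin n → ℕ) (f : (Fin n → ℝ) → ℝ) : (Fin n → ℝ) → ℝ :=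
  vfPow (fun i => fun _ => Pi.single i (1 : ℝ)) α f

/-- Lie bracket of two vector fields. -/
noncomputable def lieBk {n : ℕ} (X Y : (Fin n → ℝ) → (Fin n → ℝ)) : (Fin n → ℝ) → (Fin n → ℝ) :=
  fun x => fderiv ℝ Y x (X x) - fderiv ℝ X x (Y x)

/-- A weight sequence: non-decreasing, positive, starting at `1`. -/
structure IsWeight {n : ℕ} (w : Fin n → ℕ) : Prop where
  mono : Monotone w
  pos : ∀ i, 0 < w i
  first : ∀ h : 0 < n, w ⟨0, h⟩ = 1

/-- An `H`-frame on `V`. -/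
structure IsHFrame {n : ℕ} (w : Fin n → ℕ) (X : Fin n → (Fin n → ℝ) → (Fin n → ℝ))
    (V : Set (Fin n → ℝ)) : Prop where
  smooth : ∀ j, ContDiffOn ℝ (⊤ : ℕ∞) (X j) V
  basis : ∀ x ∈ V, LinearIndependent ℝ fun j => X j x
  bracket : ∃ L : Fin n → Fin n → Fin n → (Fin n → ℝ) → ℝ,
    (∀ i j k, ContDiffOn ℝ (⊤ : ℕ∞) (L i j k) V) ∧
    (∀ i j k, ¬ w k ≤ w i + w j → ∀ x ∈ V, L i j k x = 0) ∧
    ∀ i j, ∀ x ∈ V, lieBk (X i) (X j) x = ∑ k, L i j k x • X k x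

/-- `f` has order `≥ N` at `a` with respect to the frame `X`. -/
def OrderGe {n : ℕ} (w : Fin n → ℕ) (X : Fin n → (Fin n → ℝ) → (Fin n → ℝ))
    (f : (Fin n → ℝ) → ℝ) (a : Fin n → ℝ) (N : ℕ) : Prop :=
  ∀ I : List (Fin n), seqW w I < N → vfSeq X I f a = 0

/-- `f` has order exactly `N` at `a` with respect to the frame `X`. -/
def OrderEq {n : ℕ} (w : Fin n → ℕ) (X : Fin n → (Fin n → ℝ) → (Fin n → ℝ))
    (f : (Fin n → ℝ) → ℝ) (a : Fin n → ℝ) (N : ℕ) : Prop :=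
  OrderGe w X f a N ∧ ∃ I : List (Fin n), seqW w I = N ∧ vfSeq X I f a ≠ 0

/-- `f` has weight `≥ N`. -/
def WeightGe {n : ℕ} (w : Fin n → ℕ) (f : (Fin n → ℝ) → ℝ) (N : ℤ) : Prop :=
  ∀ α : Fin n → ℕ, (wlen w α : ℤ) < N → pdPow α f 0 = 0

/-- `f` has weight exactly `N`. -/
def WeightEq {n : ℕ} (w : Fin n → ℕ) (f : (Fin n → ℝ) → ℝ) (N : ℤ) : Prop :=
  WeightGe w f N ∧ ∃ α : Fin n → ℕ, (wlen w α : ℤ) = N ∧ pdPow α f 0 ≠ 0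

/-- A pseudo-norm for the anisotropic dilations. -/
structure IsPseudoNorm {n : ℕ} (w : Fin n → ℕ) (ρ : (Fin n → ℝ) → ℝ) : Prop where
  cont : Continuous ρ
  nonneg : ∀ x, 0 ≤ ρ x
  pos : ∀ x, x ≠ 0 → 0 < ρ x
  homog : ∀ t x, ρ (dil w t x) = |t| * ρ x

/-- Multi-indices with all entries `< B`. -/
def mIdx (n B : ℕ) : Finset (Fin n → ℕ) := Fintype.piFinset fun _ => Finset.range B

/-- The monomial `x^α`. -/
def monom {n : ℕ} (α : Fin n → ℕ) (x : Fin n → ℝ) : ℝ := ∏ i, x i ^ α i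

/-- Taylor coefficient `(1/α!) ∂^α f(0)`. -/
noncomputable def taylorCoeff {n : ℕ} (α : Fin n → ℕ) (f : (Fin n → ℝ) → ℝ) : ℝ :=
  ((∏ i, Nat.factorial (α i) : ℕ) : ℝ)⁻¹ * pdPow α f 0

/-- The homogeneous part `f^[ℓ]` of degree `ℓ` of the Taylor series of `f` at `0`. -/
noncomputable def homPart {n : ℕ} (w : Fin n → ℕ) (f : (Fin n → ℝ) → ℝ) (ℓ : ℕ) :
    (Fin n → ℝ) → ℝ :=
  fun x => ∑ α ∈ (mIdx n (ℓ + 1)).filter (fun α => wlen w α = ℓ),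
    taylorCoeff α f * monom α x

/-- `u_t = O(t^m)` in `C^∞(U)` as `t → 0`. -/
def BigOC {n : ℕ} (U : Set (Fin n → ℝ)) (u : ℝ → (Fin n → ℝ) → ℝ) (m : ℤ) : Prop :=
  ∀ K : Set (Fin n → ℝ), K ⊆ U → IsCompact K → ∀ β : Fin n → ℕ,
    ∃ C : ℝ, ∀ᶠ t in 𝓝[≠] (0 : ℝ), ∀ x ∈ K, |pdPow β (u t) x| ≤ C * |t| ^ m

/-- Componentwise `O(t^m)` in `C^∞(U)` for families of vector fields. -/
def BigOCVF {n : ℕ} (U : Set (Fin n → ℝ)) (u : ℝ → (Fin n → ℝ) → Fin n → ℝ)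
    (m : ℤ) : Prop :=
  ∀ K : Set (Fin n → ℝ), K ⊆ U → IsCompact K → ∀ β : Fin n → ℕ, ∀ k : Fin n,
    ∃ C : ℝ, ∀ᶠ t in 𝓝[≠] (0 : ℝ), ∀ x ∈ K,
      |pdPow β (fun y => u t y k) x| ≤ C * |t| ^ m

/-- `Θ = O_w(‖x‖^{w+m})` near `x = 0`. -/
def IsOw {n : ℕ} (w : Fin n → ℕ) (ρ : (Fin n → ℝ) → ℝ)
    (Θ : (Fin n → ℝ) → (Fin n → ℝ)) (m : ℤ) : Prop :=
  ∀ k, ∃ C : ℝ, ∀ᶠ x in 𝓝 (0 : Fin n → ℝ), |Θ x k| ≤ C * ρ x ^ ((w k : ℤ) + m)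

/-- A `w`-homogeneous map. -/
def WHomog {n : ℕ} (w : Fin n → ℕ) (φ : (Fin n → ℝ) → (Fin n → ℝ)) : Prop :=
  ∀ t x, φ (dil w t x) = dil w t (φ x)

/-- A map whose components are polynomial functions. -/
def IsPolyMap {n : ℕ} (φ : (Fin n → ℝ) → (Fin n → ℝ)) : Prop :=
  ∀ k, ∃ p : MvPolynomial (Fin n) ℝ, ∀ x, φ x k = MvPolynomial.eval x p

/-- A vector field homogeneous of degree `m`: `δ_t^* Y = t^m Y` for `t ≠ 0`. -/
def VFHomog {n : ℕ} (w : Fin n → ℕ) (Y : (Fin n → ℝ) → (Fin n → ℝ)) (m : ℤ) : Prop :=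
  ∀ t : ℝ, t ≠ 0 → ∀ x k, (t : ℝ) ^ (-(w k : ℤ)) * Y (dil w t x) k = t ^ m * Y x k

/-- A vector field has weight `W`: each component `X_k` has weight `≥ W + w_k`,
with equality for some `k`. -/
def VFWeightEq {n : ℕ} (w : Fin n → ℕ) (X : (Fin n → ℝ) → (Fin n → ℝ)) (W : ℤ) :
    Prop :=
  (∀ k, ∀ α : Fin n → ℕ, (wlen w α : ℤ) < W + w k →
    pdPow α (fun y => X y k) 0 = 0) ∧
  ∃ k, ∃ α : Fin n → ℕ, (wlen w α : ℤ) = W + w k ∧ pdPow α (fun y => X y k) 0 ≠ 0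

/-- The homogeneous part `X^[ℓ]` of degree `ℓ` of a vector field. -/
noncomputable def vfPart {n : ℕ} (w : Fin n → ℕ) (X : (Fin n → ℝ) → (Fin n → ℝ)) (ℓ : ℤ) :
    (Fin n → ℝ) → Fin n → ℝ :=
  fun x k => ∑ α ∈ (mIdx n ((ℓ + w k).toNat + 1)).filter
      (fun α => (wlen w α : ℤ) = ℓ + w k),
    taylorCoeff α (fun y => X y k) * monom α x

/-- `φ` produces privileged coordinates at `a` adapted to the `H`-frame `X`:
it is linearly adapted at `a` and each component has order `w_k` at `a`. -/
def PrivilegedAt {n : ℕ} (w : Fin n → ℕ) (X : Fin n → (Fin n → ℝ) → (Fin n → ℝ))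
    (a : Fin n → ℝ) (φ : (Fin n → ℝ) → (Fin n → ℝ)) : Prop :=
  (∀ j, fderiv ℝ φ a (X j a) = Pi.single j 1) ∧
  ∀ k, OrderEq w X (fun x => φ x k) a (w k)


section ParametricIntegral

variable {E F : Type} [NormedAddCommGroup E] [NormedSpace ℝ E] [FiniteDimensional ℝ E]
  [NormedAddCommGroup F] [NormedSpace ℝ F]

theorem hasFDerivAt_intervalIntegral_of_contDiff {Φ : E × ℝ → F} (hΦ : ContDiff ℝ 1 Φ) (x : E) :
    HasFDerivAt (fun y => ∫ t in (0 : ℝ)..1, Φ (y, t))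
      (∫ t in (0 : ℝ)..1, (fderiv ℝ Φ (x, t)).comp (ContinuousLinearMap.inl ℝ E ℝ)) x := by
  have hcont : Continuous fun p : E × ℝ =>
      (fderiv ℝ Φ p).comp (ContinuousLinearMap.inl ℝ E ℝ) :=
    (hΦ.continuous_fderiv one_ne_zero).clm_comp continuous_const
  obtain ⟨C, hC⟩ := ((isCompact_closedBall x 1).prod
    (isCompact_Icc (a := (0 : ℝ)) (b := 1))).exists_bound_of_continuousOn hcont.continuousOn
  refine (intervalIntegral.hasFDerivAt_integral_of_dominated_of_fderiv_le (𝕜 := ℝ)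
    (F := fun y t => Φ (y, t))
    (F' := fun y t => (fderiv ℝ Φ (y, t)).comp (ContinuousLinearMap.inl ℝ E ℝ))
    (bound := fun _ => C) (Metric.ball_mem_nhds x one_pos) ?_ ?_ ?_ ?_ ?_ ?_)
  · refine Eventually.of_forall fun y => Continuous.aestronglyMeasurable ?_
    exact hΦ.continuous.comp (by fun_prop)
  · refine Continuous.intervalIntegrable ?_ _ _
    exact hΦ.continuous.comp (by fun_prop)
  · have := secondCountableTopologyEither_of_left ℝ (E →L[ℝ] F)
    refine Continuous.aestronglyMeasurable ?_
    exact hcont.comp (by fun_prop : Continuous fun t : ℝ => (x, t))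
  · refine Eventually.of_forall fun t ht y hy => hC (y, t) ⟨Metric.ball_subset_closedBall hy, ?_⟩
    rw [Set.uIoc_of_le zero_le_one] at ht
    exact Set.Ioc_subset_Icc_self ht
  · exact intervalIntegrable_const
  · refine Eventually.of_forall fun t _ y _ => ?_
    exact ((hΦ.differentiable one_ne_zero) (y, t)).hasFDerivAt.comp y
      (hasFDerivAt_prodMk_left y t)

theorem contDiff_nat_intervalIntegral (m : ℕ) : ∀ {F : Type} [NormedAddCommGroup F]
    [NormedSpace ℝ F] {Φ : E × ℝ → F}, ContDiff ℝ (⊤ : ℕ∞) Φ →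
    ContDiff ℝ m (fun y => ∫ t in (0 : ℝ)..1, Φ (y, t)) := by
  induction m with
  | zero =>
    intro F _ _ Φ hΦ
    refine contDiff_zero.2 ?_
    exact intervalIntegral.continuous_parametric_intervalIntegral_of_continuous'
      (f := fun y t => Φ (y, t)) hΦ.continuous 0 1
  | succ m ih =>
    intro F _ _ Φ hΦ
    have hΦ1 : ContDiff ℝ 1 Φ := hΦ.of_le (by exact_mod_cast le_top)
    rw [Nat.cast_succ, contDiff_succ_iff_hasFDerivAt]
    refine ⟨_, ?_, fun x => hasFDerivAt_intervalIntegral_of_contDiff hΦ1 x⟩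
    refine ih (Φ := fun p => (fderiv ℝ Φ p).comp (ContinuousLinearMap.inl ℝ E ℝ)) ?_
    exact (hΦ.fderiv_right (by simp)).clm_comp contDiff_const

theorem contDiff_intervalIntegral {Φ : E × ℝ → F} (hΦ : ContDiff ℝ (⊤ : ℕ∞) Φ) :
    ContDiff ℝ (⊤ : ℕ∞) (fun y => ∫ t in (0 : ℝ)..1, Φ (y, t)) :=
  contDiff_infty.2 fun m => contDiff_nat_intervalIntegral m hΦ

end ParametricIntegral

section Hadamard

variable {n : ℕ}

/-- Hadamard's lemma for functions on the whole space. -/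
theorem exists_hadamard_of_contDiff {h : (Fin n → ℝ) → ℝ} (hh : ContDiff ℝ (⊤ : ℕ∞) h) :
    ∃ k : Fin n → (Fin n → ℝ) → ℝ, (∀ i, ContDiff ℝ (⊤ : ℕ∞) (k i)) ∧
      ∀ x, h x = h 0 + ∑ i, x i * k i x := by
  have hd : ContDiff ℝ (⊤ : ℕ∞) (fderiv ℝ h) := hh.fderiv_right (by simp)
  have hsm : ∀ i, ContDiff ℝ (⊤ : ℕ∞)
      (fun p : (Fin n → ℝ) × ℝ => fderiv ℝ h (p.2 • p.1) (Pi.single i 1)) := fun i =>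
    (hd.comp (contDiff_snd.smul contDiff_fst)).clm_apply contDiff_const
  refine ⟨fun i x => ∫ t in (0 : ℝ)..1, fderiv ℝ h (t • x) (Pi.single i 1),
    fun i => contDiff_intervalIntegral (hsm i), fun x => ?_⟩
  have hderiv : ∀ t ∈ Set.uIcc (0 : ℝ) 1,
      HasDerivAt (fun t : ℝ => h (t • x)) (fderiv ℝ h (t • x) x) t := fun t _ => by
    have h1 : HasDerivAt (fun t : ℝ => t • x) x t := by
      simpa using (hasDerivAt_id t).smul_const x
    exact ((hh.differentiable (by simp)) (t • x)).hasFDerivAt.comp_hasDerivAt t h1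
  have hc : Continuous fun t : ℝ => fderiv ℝ h (t • x) x :=
    (hd.continuous.comp (by fun_prop)).clm_apply continuous_const
  have hftc := intervalIntegral.integral_eq_sub_of_hasDerivAt hderiv (hc.intervalIntegrable 0 1)
  have hx : ∀ t : ℝ, fderiv ℝ h (t • x) x =
      ∑ i, x i * fderiv ℝ h (t • x) (Pi.single i 1) := fun t => by
    have hxs : x = ∑ i, x i • (Pi.single i 1 : Fin n → ℝ) := by
      simpa using pi_eq_sum_univ' x
    nth_rewrite 2 [hxs]
    simp [map_sum]
  simp only [one_smul, zero_smul, hx] at hftc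
  rw [intervalIntegral.integral_finsetSum] at hftc
  · simp only [intervalIntegral.integral_const_mul] at hftc
    linarith
  · intro i _
    refine Continuous.intervalIntegrable ?_ _ _
    exact continuous_const.mul ((hsm i).continuous.comp (by fun_prop : Continuous fun t => (x, t)))

/-- Hadamard's lemma on an arbitrary open neighborhood of the origin. -/
theorem exists_hadamard {U : Set (Fin n → ℝ)} (hU : IsOpen U) (h0 : (0 : Fin n → ℝ) ∈ U)
    {g : (Fin n → ℝ) → ℝ} (hg : ContDiffOn ℝ (⊤ : ℕ∞) g U) :
    ∃ k : Fin n → (Fin n → ℝ) → ℝ, (∀ i, ContDiffOn ℝ (⊤ : ℕ∞) (k i) U) ∧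
      ∀ x ∈ U, g x = g 0 + ∑ i, x i * k i x := by
  obtain ⟨r, hr, hrU⟩ := Metric.nhds_basis_closedBall.mem_iff.1 (hU.mem_nhds h0)
  let χ : ContDiffBump (0 : Fin n → ℝ) := ⟨r / 2, r, half_pos hr, half_lt_self hr⟩
  have hχg : ContDiff ℝ (⊤ : ℕ∞) fun x => χ x * g x := by
    refine contDiff_iff_contDiffAt.2 fun x => ?_
    by_cases hx : x ∈ U
    · exact χ.contDiff.contDiffAt.mul (hg.contDiffAt (hU.mem_nhds hx))
    · have hx' : x ∉ tsupport χ := fun h => hx (hrU (by rwa [χ.tsupport_eq] at h))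
      refine (contDiffAt_const (c := (0 : ℝ))).congr_of_eventuallyEq ?_
      filter_upwards [(isClosed_tsupport χ).isOpen_compl.mem_nhds hx'] with y hy
      rw [image_eq_zero_of_notMem_tsupport hy, zero_mul]
  obtain ⟨k, hk, hkx⟩ := exists_hadamard_of_contDiff hχg
  have hone : (χ : (Fin n → ℝ) → ℝ) =ᶠ[𝓝 0] 1 := χ.eventuallyEq_one
  refine ⟨fun i x => k i x + x i * ((1 - χ x) * g x) / ∑ j, x j ^ 2, fun i x hx => ?_,
    fun x hx => ?_⟩
  · refine ContDiffAt.contDiffWithinAt ((hk i).contDiffAt.add ?_)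
    by_cases hx0 : x = 0
    · subst hx0
      refine (contDiffAt_const (c := (0 : ℝ))).congr_of_eventuallyEq ?_
      filter_upwards [hone] with y hy
      simp [hy]
    · refine ContDiffAt.div ?_ ?_ (fun h => hx0 ?_)
      · exact (contDiff_apply ℝ ℝ i).contDiffAt.mul ((contDiffAt_const.sub χ.contDiff.contDiffAt).mul
          (hg.contDiffAt (hU.mem_nhds hx)))
      · exact (ContDiff.sum fun j _ => (contDiff_apply ℝ ℝ j).pow 2).contDiffAt
      · rw [Finset.sum_eq_zero_iff_of_nonneg fun j _ => sq_nonneg (x j)] at h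
        exact funext fun j => by simpa using h j (Finset.mem_univ j)
  · have hχ0 : χ 0 = 1 := hone.eq_of_nhds
    have h1 := hkx x
    simp only [hχ0, one_mul] at h1
    simp only [mul_add, Finset.sum_add_distrib]
    have h2 : ∑ i, x i * (x i * ((1 - χ x) * g x) / ∑ j, x j ^ 2) = (1 - χ x) * g x := by
      by_cases hx0 : x = 0
      · subst hx0
        simp [hχ0]
      · have hne : ∑ j, x j ^ 2 ≠ 0 := fun h => hx0 <| by
          rw [Finset.sum_eq_zero_iff_of_nonneg fun j _ => sq_nonneg (x j)] at h
          exact funext fun j => by simpa using h j (Finset.mem_univ j)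
        have : ∀ i, x i * (x i * ((1 - χ x) * g x) / ∑ j, x j ^ 2) =
            x i ^ 2 * ((1 - χ x) * g x / ∑ j, x j ^ 2) := fun i => by ring
        simp only [this, ← Finset.sum_mul]
        field_simp
    rw [h2]
    linarith

end Hadamard

section PartialDerivatives

variable {n : ℕ} {U : Set (Fin n → ℝ)}

/-- The coordinate vector fields `∂_1, …, ∂_n`. -/
abbrev coordField (n : ℕ) : Fin n → (Fin n → ℝ) → (Fin n → ℝ) :=
  fun i => fun _ => Pi.single i (1 : ℝ)

theorem contDiffOn_vf (hU : IsOpen U) {f : (Fin n → ℝ) → ℝ} (hf : ContDiffOn ℝ (⊤ : ℕ∞) f U)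
    (i : Fin n) : ContDiffOn ℝ (⊤ : ℕ∞) (vf (coordField n i) f) U :=
  (hf.fderiv_of_isOpen hU (by simp)).clm_apply contDiffOn_const

theorem contDiffOn_vfSeq (hU : IsOpen U) {f : (Fin n → ℝ) → ℝ}
    (hf : ContDiffOn ℝ (⊤ : ℕ∞) f U) (I : List (Fin n)) :
    ContDiffOn ℝ (⊤ : ℕ∞) (vfSeq (coordField n) I f) U := by
  induction I with
  | nil => exact hf
  | cons i I ih => exact contDiffOn_vf hU ih i

theorem vf_congr (hU : IsOpen U) {f g : (Fin n → ℝ) → ℝ} (hfg : Set.EqOn f g U)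
    (X : (Fin n → ℝ) → (Fin n → ℝ)) : Set.EqOn (vf X f) (vf X g) U := fun x hx => by
  rw [vf, vf, (hfg.eventuallyEq_of_mem (hU.mem_nhds hx)).fderiv_eq]

theorem vfSeq_congr (hU : IsOpen U) {f g : (Fin n → ℝ) → ℝ} (hfg : Set.EqOn f g U)
    (X : Fin n → (Fin n → ℝ) → (Fin n → ℝ)) (I : List (Fin n)) :
    Set.EqOn (vfSeq X I f) (vfSeq X I g) U := by
  induction I with
  | nil => exact hfg
  | cons i I ih => exact vf_congr hU ih (X i)

theorem vfSeq_add (hU : IsOpen U) {f g : (Fin n → ℝ) → ℝ} (hf : ContDiffOn ℝ (⊤ : ℕ∞) f U)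
    (hg : ContDiffOn ℝ (⊤ : ℕ∞) g U) (I : List (Fin n)) :
    Set.EqOn (vfSeq (coordField n) I fun x => f x + g x)
      (fun x => vfSeq (coordField n) I f x + vfSeq (coordField n) I g x) U := by
  induction I with
  | nil => exact fun _ _ => rfl
  | cons i I ih =>
    refine (vf_congr hU ih _).trans fun x hx => ?_
    have hd : ∀ {k : (Fin n → ℝ) → ℝ}, ContDiffOn ℝ (⊤ : ℕ∞) k U →
        DifferentiableAt ℝ (vfSeq (coordField n) I k) x := fun hk =>
      ((contDiffOn_vfSeq hU hk I).contDiffAt (hU.mem_nhds hx)).differentiableAt (by simp)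
    simp only [vf, vfSeq]
    rw [fderiv_fun_add (hd hf) (hd hg), add_apply]

theorem vfSeq_sum (hU : IsOpen U) {ι : Type*} (s : Finset ι) {f : ι → (Fin n → ℝ) → ℝ}
    (hf : ∀ j ∈ s, ContDiffOn ℝ (⊤ : ℕ∞) (f j) U) (I : List (Fin n)) :
    Set.EqOn (vfSeq (coordField n) I fun x => ∑ j ∈ s, f j x)
      (fun x => ∑ j ∈ s, vfSeq (coordField n) I (f j) x) U := by
  induction I with
  | nil => exact fun _ _ => rfl
  | cons i I ih =>
    refine (vf_congr hU ih _).trans fun x hx => ?_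
    have hd : ∀ j ∈ s, DifferentiableAt ℝ (vfSeq (coordField n) I (f j)) x := fun j hj =>
      ((contDiffOn_vfSeq hU (hf j hj) I).contDiffAt (hU.mem_nhds hx)).differentiableAt (by simp)
    simp only [vf, vfSeq]
    rw [fderiv_fun_sum hd, sum_apply]

theorem vfSeq_const_mul {f : (Fin n → ℝ) → ℝ} (X : Fin n → (Fin n → ℝ) → (Fin n → ℝ)) (c : ℝ)
    (I : List (Fin n)) :
    vfSeq X I (fun x => c * f x) = fun x => c * vfSeq X I f x := by
  induction I with
  | nil => rfl
  | cons i I ih =>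
    funext x
    simp only [vfSeq, vf, ih]
    change fderiv ℝ (c • vfSeq X I f) x _ = _
    rw [fderiv_const_smul_field]
    simp

theorem exists_vfSeq_eq_pow_mul (hU : IsOpen U) (i : Fin n) (m : ℕ) {g : (Fin n → ℝ) → ℝ}
    (hg : ContDiffOn ℝ (⊤ : ℕ∞) g U) (I : List (Fin n)) :
    ∃ h : (Fin n → ℝ) → ℝ, ContDiffOn ℝ (⊤ : ℕ∞) h U ∧
      ∀ x ∈ U, vfSeq (coordField n) I (fun x => x i ^ m * g x) x =
        x i ^ (m - I.count i) * h x := by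
  induction I with
  | nil => exact ⟨g, hg, fun x _ => by simp [vfSeq]⟩
  | cons j I ih =>
    obtain ⟨h, hh, hx⟩ := ih
    have hvf : ∀ x ∈ U, vfSeq (coordField n) (j :: I) (fun x => x i ^ m * g x) x =
        x i ^ (m - I.count i) * vf (coordField n j) h x +
          h x * ((m - I.count i : ℕ) * x i ^ (m - I.count i - 1) * (Pi.single j 1 : Fin n → ℝ) i) :=
      fun x hxU => by
        refine (vf_congr hU hx (coordField n j) hxU).trans ?_
        have hd := ((hh.contDiffAt (hU.mem_nhds hxU)).differentiableAt (by simp)).hasFDerivAt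
        have := ((hasFDerivAt_apply (𝕜 := ℝ) i x).pow (m - I.count i)).mul hd
        simp only [vf]
        erw [this.fderiv]
        simp
    by_cases hij : j = i
    · subst hij
      rcases Nat.eq_zero_or_pos (m - I.count j) with h0 | hpos
      · refine ⟨vf (coordField n j) h, contDiffOn_vf hU hh j, fun x hxU => ?_⟩
        rw [hvf x hxU, List.count_cons_self, ← Nat.sub_sub, h0]
        simp
      · refine ⟨fun x => x j * vf (coordField n j) h x + (m - I.count j : ℕ) * h x, ?_,
          fun x hxU => ?_⟩
        · exact ((contDiff_apply ℝ ℝ j).contDiffOn.mul (contDiffOn_vf hU hh j)).add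
            (contDiffOn_const.mul hh)
        · rw [hvf x hxU, List.count_cons_self, ← Nat.sub_sub]
          obtain ⟨p, hp⟩ := Nat.exists_eq_add_of_lt hpos
          rw [hp]
          simp [pow_succ]
          ring
    · refine ⟨vf (coordField n j) h, contDiffOn_vf hU hh j, fun x hxU => ?_⟩
      rw [hvf x hxU, List.count_cons_of_ne hij]
      simp [Pi.single_eq_of_ne' hij]

theorem count_multiList (α : Fin n → ℕ) (i : Fin n) : (multiList α).count i = α i := by
  have : ∀ j : Fin n, (List.count i ∘ fun j => List.replicate (α j) j) j =
      if j = i then α j else 0 := fun j => by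
    simp [List.count_replicate]
  rw [multiList, List.count_flatMap, funext this, ← List.ofFn_eq_map, List.sum_ofFn]
  simp

theorem contDiff_monom (α : Fin n → ℕ) : ContDiff ℝ (⊤ : ℕ∞) (monom α) :=
  contDiff_prod fun i _ => (contDiff_apply ℝ ℝ i).pow (α i)

theorem monom_mul_apply (α : Fin n → ℕ) (i : Fin n) (x : Fin n → ℝ) :
    monom α x * x i = monom (α + Pi.single i 1) x := by
  simp only [monom, Pi.add_apply, pow_add, Finset.prod_mul_distrib]
  congr 1
  rw [Finset.prod_eq_single i] <;> simp +contextual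

theorem pdPow_monom_mul_zero_of_lt (hU : IsOpen U) (h0 : (0 : Fin n → ℝ) ∈ U)
    {α β : Fin n → ℕ} {i : Fin n} (hi : β i < α i) {g : (Fin n → ℝ) → ℝ}
    (hg : ContDiffOn ℝ (⊤ : ℕ∞) g U) :
    pdPow β (fun x => monom α x * g x) 0 = 0 := by
  have hrest : ContDiffOn ℝ (⊤ : ℕ∞)
      (fun x => (∏ j ∈ Finset.univ.erase i, x j ^ α j) * g x) U :=
    (contDiff_prod fun j _ => (contDiff_apply ℝ ℝ j).pow (α j)).contDiffOn.mul hg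
  obtain ⟨h, -, hh⟩ := exists_vfSeq_eq_pow_mul hU i (α i) hrest (multiList β)
  have heq : (fun x => monom α x * g x) =
      fun x => x i ^ α i * ((∏ j ∈ Finset.univ.erase i, x j ^ α j) * g x) := by
    funext x
    rw [monom, ← Finset.mul_prod_erase _ _ (Finset.mem_univ i), mul_assoc]
  have := hh 0 h0
  rw [count_multiList] at this
  rw [pdPow, vfPow, heq, this, Pi.zero_apply, zero_pow (Nat.sub_ne_zero_of_lt hi), zero_mul]

theorem vf_monom (α : Fin n → ℕ) (i : Fin n) :
    vf (coordField n i) (monom α) = fun x => α i * monom (α - Pi.single i 1) x := by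
  funext x
  have h := HasFDerivAt.finsetProd (u := Finset.univ) (x := x) (fun (j : Fin n) _ =>
    (hasFDerivAt_apply (𝕜 := ℝ) (F' := fun _ : Fin n => ℝ) j x).pow (α j))
  have hm : monom α = fun x => ∏ j, x j ^ α j := rfl
  have hrest : ∀ j ∈ Finset.univ.erase i, (α - Pi.single i 1 : Fin n → ℕ) j = α j := fun j hj => by
    simp [Pi.single_eq_of_ne (Finset.ne_of_mem_erase hj)]
  rw [vf, hm, h.fderiv, sum_apply, Finset.sum_eq_single i]
  · rw [monom, ← Finset.mul_prod_erase _ _ (Finset.mem_univ i),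
      Finset.prod_congr rfl fun j hj => congrArg (x j ^ ·) (hrest j hj)]
    simp
    ring
  · intro j _ hj
    simp [hj]
  · simp

theorem vfSeq_monom (α : Fin n → ℕ) (I : List (Fin n)) :
    vfSeq (coordField n) I (monom α) = fun x =>
      (∏ i, (α i).descFactorial (I.count i) : ℕ) * monom (fun i => α i - I.count i) x := by
  induction I with
  | nil => simp [vfSeq]
  | cons j I ih =>
    have hcount : ∀ i, (α i).descFactorial ((j :: I).count i) =
        (if i = j then α i - I.count i else 1) * (α i).descFactorial (I.count i) := fun i => by
      by_cases h : i = j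
      · subst h
        simp [Nat.descFactorial_succ]
      · simp [h, List.count_cons_of_ne (Ne.symm h)]
    have hexp : (fun i => α i - I.count i) - Pi.single j 1 = fun i => α i - (j :: I).count i := by
      funext i
      by_cases h : i = j
      · subst h
        simp [Nat.sub_sub]
      · simp [h, List.count_cons_of_ne (Ne.symm h)]
    have hvf := vfSeq_const_mul (f := monom fun i => α i - I.count i) (coordField n)
      ((∏ i, (α i).descFactorial (I.count i) : ℕ) : ℝ) [j]
    simp only [vfSeq, vf_monom, hexp] at hvf
    rw [vfSeq, ih, hvf]
    simp only [hcount, Finset.prod_mul_distrib]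
    funext x
    simp
    ring

theorem pdPow_monom_zero (α β : Fin n → ℕ) :
    pdPow β (monom α) 0 = if α = β then ((∏ i, (α i).factorial : ℕ) : ℝ) else 0 := by
  rw [pdPow, vfPow, vfSeq_monom]
  simp only [count_multiList]
  split_ifs with h
  · subst h
    simp [monom, Nat.descFactorial_self]
  · obtain ⟨i, hi⟩ := Function.ne_iff.1 h
    rcases lt_or_gt_of_ne hi with hi | hi
    · rw [Finset.prod_eq_zero (Finset.mem_univ i) (Nat.descFactorial_of_lt hi)]
      simp
    · refine mul_eq_zero_of_right _ (Finset.prod_eq_zero (Finset.mem_univ i) ?_)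
      simp [Nat.sub_ne_zero_of_lt hi]

end PartialDerivatives

section Taylor

variable {n : ℕ} {U : Set (Fin n → ℝ)}

/-- `f` is on `U` a combination of the monomials `x^α`, `α ∈ S`, with smooth coefficients. -/
def IsMonomComb (U : Set (Fin n → ℝ)) (S : Finset (Fin n → ℕ)) (f : (Fin n → ℝ) → ℝ) : Prop :=
  ∃ G : (Fin n → ℕ) → (Fin n → ℝ) → ℝ, (∀ α, ContDiffOn ℝ (⊤ : ℕ∞) (G α) U) ∧
    ∀ x ∈ U, f x = ∑ α ∈ S, monom α x * G α x

namespace IsMonomComb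

variable {S : Finset (Fin n → ℕ)}

theorem congr {f g : (Fin n → ℝ) → ℝ} (hf : IsMonomComb U S f) (hfg : Set.EqOn g f U) :
    IsMonomComb U S g := by
  obtain ⟨G, hG, hfG⟩ := hf
  exact ⟨G, hG, fun x hx => (hfg hx).trans (hfG x hx)⟩

theorem zero : IsMonomComb U S fun _ => 0 :=
  ⟨fun _ _ => 0, fun _ => contDiffOn_const, fun x _ => by simp⟩

theorem add {f g : (Fin n → ℝ) → ℝ} (hf : IsMonomComb U S f) (hg : IsMonomComb U S g) :
    IsMonomComb U S fun x => f x + g x := by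
  obtain ⟨G, hG, hfG⟩ := hf
  obtain ⟨K, hK, hgK⟩ := hg
  refine ⟨fun α x => G α x + K α x, fun α => (hG α).add (hK α), fun x hx => ?_⟩
  simp only [mul_add, Finset.sum_add_distrib, hfG x hx, hgK x hx]

theorem sum {ι : Type*} {s : Finset ι} {f : ι → (Fin n → ℝ) → ℝ}
    (hf : ∀ j ∈ s, IsMonomComb U S (f j)) : IsMonomComb U S fun x => ∑ j ∈ s, f j x := by
  classical
  induction s using Finset.induction_on with
  | empty => simpa using zero
  | insert j s hj ih =>
    simp only [Finset.sum_insert hj]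
    exact (hf j (Finset.mem_insert_self j s)).add
      (ih fun k hk => hf k (Finset.mem_insert_of_mem hk))

theorem monom_mul {α : Fin n → ℕ} (hα : α ∈ S) {g : (Fin n → ℝ) → ℝ}
    (hg : ContDiffOn ℝ (⊤ : ℕ∞) g U) : IsMonomComb U S fun x => monom α x * g x := by
  classical
  refine ⟨fun β => if β = α then g else fun _ => 0, fun β => ?_, fun x _ => ?_⟩
  · dsimp only
    split_ifs
    exacts [hg, contDiffOn_const]
  · rw [Finset.sum_eq_single_of_mem α hα fun β _ hβ => by simp [hβ]]
    simp

end IsMonomComb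

theorem IsMonomComb.contDiffOn {S : Finset (Fin n → ℕ)} {f : (Fin n → ℝ) → ℝ}
    (hf : IsMonomComb U S f) : ContDiffOn ℝ (⊤ : ℕ∞) f U := by
  obtain ⟨G, hG, hfG⟩ := hf
  exact (ContDiffOn.sum fun α _ => (contDiff_monom α).contDiffOn.mul (hG α)).congr hfG

theorem mlen_add_single (α : Fin n → ℕ) (i : Fin n) :
    mlen (α + Pi.single i 1) = mlen α + 1 := by
  simp [mlen, Finset.sum_add_distrib]

theorem mlen_le_wlen {w : Fin n → ℕ} (hw : IsWeight w) (α : Fin n → ℕ) : mlen α ≤ wlen w α :=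
  Finset.sum_le_sum fun i _ => Nat.le_mul_of_pos_left _ (hw.pos i)

theorem mem_mIdx_of_mlen_lt {α : Fin n → ℕ} {B : ℕ} (h : mlen α < B) : α ∈ mIdx n B :=
  Fintype.mem_piFinset.2 fun i => Finset.mem_range.2 <|
    (Finset.single_le_sum (fun _ _ => Nat.zero_le _) (Finset.mem_univ i)).trans_lt h

/-- Isotropic Taylor expansion with smooth remainder coefficients. -/
theorem exists_isotropic_taylor (hU : IsOpen U) (h0 : (0 : Fin n → ℝ) ∈ U)
    {f : (Fin n → ℝ) → ℝ} (hf : ContDiffOn ℝ (⊤ : ℕ∞) f U) (M : ℕ) :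
    ∃ (c : (Fin n → ℕ) → ℝ) (r : (Fin n → ℝ) → ℝ),
      IsMonomComb U ((mIdx n (M + 1)).filter fun α => mlen α = M) r ∧
      ∀ x ∈ U, f x = (∑ α ∈ (mIdx n M).filter (fun α => mlen α < M), c α * monom α x) + r x := by
  induction M with
  | zero =>
    refine ⟨0, f, ?_, fun x _ => by simp⟩
    refine (IsMonomComb.monom_mul (α := 0) ?_ hf).congr fun x _ => by simp [monom]
    exact Finset.mem_filter.2 ⟨mem_mIdx_of_mlen_lt (by simp [mlen]), by simp [mlen]⟩
  | succ M ih =>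
    obtain ⟨c, r, ⟨G, hG, hr⟩, hfr⟩ := ih
    choose K hK hGK using fun α => exists_hadamard hU h0 (hG α)
    refine ⟨fun α => if mlen α = M then G α 0 else c α,
      fun x => ∑ α ∈ (mIdx n (M + 1)).filter (fun α => mlen α = M),
        ∑ i, monom (α + Pi.single i 1) x * K α i x, ?_, fun x hx => ?_⟩
    · refine IsMonomComb.sum fun α hα => IsMonomComb.sum fun i _ =>
        IsMonomComb.monom_mul ?_ (hK α i)
      have hlen : mlen (α + Pi.single i 1) = M + 1 := by
        rw [mlen_add_single, (Finset.mem_filter.1 hα).2]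
      exact Finset.mem_filter.2 ⟨mem_mIdx_of_mlen_lt (by omega), hlen⟩
    · have hsplit : (mIdx n (M + 1)).filter (fun α => mlen α < M + 1) =
          (mIdx n M).filter (fun α => mlen α < M) ∪
            (mIdx n (M + 1)).filter (fun α => mlen α = M) := by
        ext α
        simp only [Finset.mem_union, Finset.mem_filter]
        constructor
        · rintro ⟨h, h'⟩
          rcases Nat.lt_succ_iff_lt_or_eq.1 h' with h' | h'
          exacts [Or.inl ⟨mem_mIdx_of_mlen_lt h', h'⟩, Or.inr ⟨h, h'⟩]
        · rintro (⟨-, h⟩ | ⟨h, h'⟩)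
          exacts [⟨mem_mIdx_of_mlen_lt (by omega), by omega⟩, ⟨h, by omega⟩]
      have hdisj : Disjoint ((mIdx n M).filter (fun α => mlen α < M))
          ((mIdx n (M + 1)).filter (fun α => mlen α = M)) :=
        Finset.disjoint_left.2 fun α h h' =>
          (Finset.mem_filter.1 h).2.ne (Finset.mem_filter.1 h').2
      rw [hfr x hx, hr x hx, hsplit, Finset.sum_union hdisj, add_assoc,
        ← Finset.sum_add_distrib]
      congr 1
      · refine Finset.sum_congr rfl fun α hα => ?_
        dsimp only
        rw [if_neg (Finset.mem_filter.1 hα).2.ne]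
      · refine Finset.sum_congr rfl fun α hα => ?_
        dsimp only
        rw [if_pos (Finset.mem_filter.1 hα).2, hGK α x hx, mul_add, Finset.mul_sum, mul_comm]
        congr 1
        refine Finset.sum_congr rfl fun i _ => ?_
        rw [← monom_mul_apply, mul_assoc]

theorem IsMonomComb.pdPow_zero_eq_zero (hU : IsOpen U) (h0 : (0 : Fin n → ℝ) ∈ U)
    {S : Finset (Fin n → ℕ)} {f : (Fin n → ℝ) → ℝ} (hf : IsMonomComb U S f) {β : Fin n → ℕ}
    (hβ : ∀ α ∈ S, ∃ i, β i < α i) : pdPow β f 0 = 0 := by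
  obtain ⟨G, hG, hfG⟩ := hf
  have hcongr : pdPow β f 0 = _ := vfSeq_congr hU hfG (coordField n) (multiList β) h0
  rw [hcongr, vfSeq_sum hU S (fun α _ => (contDiff_monom α).contDiffOn.mul (hG α)) _ h0]
  refine Finset.sum_eq_zero fun α hα => ?_
  obtain ⟨i, hi⟩ := hβ α hα
  exact pdPow_monom_mul_zero_of_lt hU h0 hi (hG α)

theorem exists_lt_of_wlen_lt {w α β : Fin n → ℕ} (h : wlen w β < wlen w α) :
    ∃ i, β i < α i := by
  obtain ⟨i, -, hi⟩ := Finset.exists_lt_of_sum_lt h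
  exact ⟨i, Nat.lt_of_mul_lt_mul_left hi⟩

theorem exists_lt_of_mlen_lt {α β : Fin n → ℕ} (h : mlen β < mlen α) : ∃ i, β i < α i := by
  obtain ⟨i, -, hi⟩ := Finset.exists_lt_of_sum_lt h
  exact ⟨i, hi⟩

/-- The coefficients of an isotropic expansion are the Taylor coefficients. -/
theorem taylorCoeff_eq_of_expansion (hU : IsOpen U) (h0 : (0 : Fin n → ℝ) ∈ U)
    {f r : (Fin n → ℝ) → ℝ} {c : (Fin n → ℕ) → ℝ} {M : ℕ}
    (hr : IsMonomComb U ((mIdx n (M + 1)).filter fun α => mlen α = M) r)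
    (hfr : ∀ x ∈ U,
      f x = (∑ α ∈ (mIdx n M).filter (fun α => mlen α < M), c α * monom α x) + r x)
    {β : Fin n → ℕ} (hβ : mlen β < M) : taylorCoeff β f = c β := by
  have hmem : β ∈ (mIdx n M).filter fun α => mlen α < M :=
    Finset.mem_filter.2 ⟨mem_mIdx_of_mlen_lt hβ, hβ⟩
  have hsum : pdPow β f 0 = c β * ((∏ i, (β i).factorial : ℕ) : ℝ) := by
    have hr0 : pdPow β r 0 = 0 := hr.pdPow_zero_eq_zero hU h0 fun α hα =>
      exists_lt_of_mlen_lt (hβ.trans_eq (Finset.mem_filter.1 hα).2.symm)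
    have hcm : ∀ α, ContDiffOn ℝ (⊤ : ℕ∞) (fun x => c α * monom α x) U := fun α =>
      contDiffOn_const.mul (contDiff_monom α).contDiffOn
    have hcongr : pdPow β f 0 = _ := vfSeq_congr hU hfr (coordField n) (multiList β) h0
    have hterm : ∀ α, vfSeq (coordField n) (multiList β) (fun x => c α * monom α x) 0 =
        c α * if α = β then ((∏ i, (α i).factorial : ℕ) : ℝ) else 0 := fun α => by
      rw [vfSeq_const_mul, ← pdPow_monom_zero]
      rfl
    rw [hcongr, vfSeq_add hU (ContDiffOn.sum fun α _ => hcm α) hr.contDiffOn _ h0]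
    dsimp only
    rw [vfSeq_sum hU _ (fun α _ => hcm α) _ h0, show vfSeq _ (multiList β) r 0 = 0 from hr0]
    simp only [hterm]
    rw [Finset.sum_eq_single_of_mem β hmem fun α _ hα => by rw [if_neg hα, mul_zero]]
    simp
  have hne : ((∏ i, (β i).factorial : ℕ) : ℝ) ≠ 0 :=
    Nat.cast_ne_zero.2 (Finset.prod_ne_zero_iff.2 fun i _ => (β i).factorial_ne_zero)
  rw [taylorCoeff, hsum]
  field_simp

end Taylor

/-- Anisotropic Taylor formula. -/
theorem anisotropic_taylor
    {n : ℕ} (hn : 0 < n) {w : Fin n → ℕ} (hw : IsWeight w)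
    {U : Set (Fin n → ℝ)} (hU : IsOpen U) (h0 : (0 : Fin n → ℝ) ∈ U)
    {f : (Fin n → ℝ) → ℝ} (hf : ContDiffOn ℝ (⊤ : ℕ∞) f U)
    {N : ℕ} (hN : 1 ≤ N) :
    ∃ R : (Fin n → ℝ) → ℝ, ∃ Rc : (Fin n → ℕ) → (Fin n → ℝ) → ℝ,
      ContDiffOn ℝ (⊤ : ℕ∞) R U ∧
      WeightGe w R N ∧
      (∀ α, ContDiffOn ℝ (⊤ : ℕ∞) (Rc α) U) ∧
      (∀ x ∈ U, f x =
        (∑ α ∈ (mIdx n N).filter (fun α => wlen w α < N),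
          taylorCoeff α f * monom α x) + R x) ∧
      (∀ x ∈ U, R x =
        ∑ α ∈ (mIdx n (N + 1)).filter (fun α => mlen α ≤ N ∧ N ≤ wlen w α),
          monom α x * Rc α x) := by
  obtain ⟨c, r, hr, hfr⟩ := exists_isotropic_taylor hU h0 hf N
  have hc : ∀ α, mlen α < N → taylorCoeff α f = c α := fun α hα =>
    taylorCoeff_eq_of_expansion hU h0 hr hfr hα
  set S := (mIdx n (N + 1)).filter fun α => mlen α ≤ N ∧ N ≤ wlen w α
  have hR : IsMonomComb U S fun x => f x -
      ∑ α ∈ (mIdx n N).filter (fun α => wlen w α < N), taylorCoeff α f * monom α x := by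
    have hhigh : IsMonomComb U S fun x =>
        ∑ α ∈ ((mIdx n N).filter fun α => mlen α < N).filter (fun α => ¬ wlen w α < N),
          monom α x * c α := by
      refine IsMonomComb.sum fun α hα => IsMonomComb.monom_mul ?_ contDiffOn_const
      simp only [Finset.mem_filter, not_lt] at hα
      exact Finset.mem_filter.2 ⟨mem_mIdx_of_mlen_lt (by omega), hα.1.2.le, hα.2⟩
    have hr' : IsMonomComb U S r := by
      obtain ⟨G, hG, hrG⟩ := hr
      refine (IsMonomComb.sum fun α hα => IsMonomComb.monom_mul ?_ (hG α)).congr hrG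
      obtain ⟨hα, hlen⟩ := Finset.mem_filter.1 hα
      exact Finset.mem_filter.2 ⟨hα, hlen.le, hlen.symm.le.trans (mlen_le_wlen hw α)⟩
    refine (hhigh.add hr').congr fun x hx => ?_
    have hlow : ((mIdx n N).filter fun α => mlen α < N).filter (fun α => wlen w α < N) =
        (mIdx n N).filter (fun α => wlen w α < N) := by
      rw [Finset.filter_filter]
      exact Finset.filter_congr fun α _ =>
        ⟨And.right, fun h => ⟨(mlen_le_wlen hw α).trans_lt h, h⟩⟩
    have hcoeff : ∑ α ∈ (mIdx n N).filter (fun α => wlen w α < N), taylorCoeff α f * monom α x =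
        ∑ α ∈ (mIdx n N).filter (fun α => wlen w α < N), c α * monom α x :=
      Finset.sum_congr rfl fun α hα => by
        rw [hc α ((mlen_le_wlen hw α).trans_lt (Finset.mem_filter.1 hα).2)]
    simp only [hcoeff, hfr x hx, mul_comm (monom _ x)]
    rw [← Finset.sum_filter_add_sum_filter_not _ (fun α => wlen w α < N), hlow]
    ring
  have hweight : WeightGe w (fun x => f x -
      ∑ α ∈ (mIdx n N).filter (fun α => wlen w α < N), taylorCoeff α f * monom α x) N :=
    fun β hβ => hR.pdPow_zero_eq_zero hU h0 fun α hα =>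
      exists_lt_of_wlen_lt ((Nat.cast_lt.1 hβ).trans_le (Finset.mem_filter.1 hα).2.2)
  obtain ⟨G, hG, hRG⟩ := hR
  refine ⟨_, G, hf.sub ?_, hweight, hG, fun x _ => (add_sub_cancel _ _).symm, hRG⟩
  exact ContDiffOn.sum fun α _ => contDiffOn_const.mul (contDiff_monom α).contDiffOn

end Carnot
end

section
/- Let U_1 and U_2 be open neighborhoods of 0 in ℝⁿ, let φ : U_1 → U_2 be a smooth diffeomorphism with φ(0) = 0, let ‖·‖ be a pseudo-norm on ℝⁿ, and let m ∈ ℕ, m ≥ 1. Suppose that near x = 0, φ(x) = φ̂(x) + O_w(‖x‖^{w+m}), where φ̂ is a w-homogeneous polynomial map. Then φ̂ is a diffeomorphism of ℝⁿ onto itself, and near x = 0 one has φ^{-1}(x) = φ̂^{-1}(x) + O_w(‖x‖^{w+m}). -/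
open scoped BigOperators
open Filter Topology

namespace Carnot

section Dilations

variable {n : ℕ} {w : Fin n → ℕ}

lemma dil_dil (s t : ℝ) (x : Fin n → ℝ) : dil w s (dil w t x) = dil w (s * t) x := by
  funext i; simp only [dil]; ring

lemma dil_one (x : Fin n → ℝ) : dil w 1 x = x := by
  funext i; simp [dil]

lemma dil_inv_dil {t : ℝ} (ht : t ≠ 0) (x : Fin n → ℝ) : dil w t⁻¹ (dil w t x) = x := by
  rw [dil_dil, inv_mul_cancel₀ ht, dil_one]

lemma dil_dil_inv {t : ℝ} (ht : t ≠ 0) (x : Fin n → ℝ) : dil w t (dil w t⁻¹ x) = x := by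
  rw [dil_dil, mul_inv_cancel₀ ht, dil_one]

lemma dil_add (t : ℝ) (x y : Fin n → ℝ) : dil w t (x + y) = dil w t x + dil w t y := by
  funext i; simp only [dil, Pi.add_apply]; ring

lemma dil_zero_left (hw : IsWeight w) (x : Fin n → ℝ) : dil w 0 x = 0 := by
  funext i; simp [dil, (hw.pos i).ne']

lemma dil_single (t : ℝ) (j : Fin n) :
    dil w t (Pi.single j 1) = Pi.single j (t ^ w j) := by
  funext i
  by_cases h : i = j
  · subst h; simp [dil]
  · simp [dil, h]

lemma contDiff_dil {k : WithTop ℕ∞} (t : ℝ) : ContDiff ℝ k (dil w t) := by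
  unfold dil; fun_prop

lemma continuous_dil_left (x : Fin n → ℝ) : Continuous fun t => dil w t x := by
  unfold dil; fun_prop

lemma tendsto_dil_zero (hw : IsWeight w) (x : Fin n → ℝ) :
    Tendsto (fun t => dil w t x) (𝓝 0) (𝓝 0) := by
  simpa [dil_zero_left hw] using (continuous_dil_left (w := w) x).tendsto 0

lemma eventually_ne_dil (hw : IsWeight w) (x : Fin n → ℝ) {P : (Fin n → ℝ) → Prop}
    (hP : ∀ᶠ z in 𝓝 0, P z) : ∀ᶠ t in 𝓝[≠] (0 : ℝ), t ≠ 0 ∧ P (dil w t x) :=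
  (eventually_mem_nhdsWithin (s := {0}ᶜ)).and
    (((tendsto_dil_zero hw x).eventually hP).filter_mono nhdsWithin_le_nhds)

lemma WHomog.map_zero (hw : IsWeight w) {f : (Fin n → ℝ) → (Fin n → ℝ)} (hf : WHomog w f) :
    f 0 = 0 := by
  simpa [dil_zero_left hw] using hf 0 0

lemma IsPseudoNorm.map_zero (hw : IsWeight w) {ρ : (Fin n → ℝ) → ℝ} (hρ : IsPseudoNorm w ρ) :
    ρ 0 = 0 := by
  simpa [dil_zero_left hw] using hρ.homog 0 0

/-- A continuous function which is positive on a compact set has a positive lower bound there. -/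
lemma exists_pos_le_of_isCompact {K : Set (Fin n → ℝ)} (hK : IsCompact K)
    {f : (Fin n → ℝ) → ℝ} (hf : Continuous f) (hpos : ∀ x ∈ K, 0 < f x) :
    ∃ c > 0, ∀ x ∈ K, c ≤ f x := by
  rcases K.eq_empty_or_nonempty with rfl | hne
  · exact ⟨1, one_pos, by simp⟩
  · obtain ⟨x, hx, hmin⟩ := hK.exists_isMinOn hne hf.continuousOn
    exact ⟨f x, hpos x hx, fun y hy => hmin hy⟩

lemma IsPseudoNorm.isCompact_sublevel (hw : IsWeight w) {ρ : (Fin n → ℝ) → ℝ}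
    (hρ : IsPseudoNorm w ρ) {R : ℝ} (hR : 0 < R) : IsCompact {x | ρ x ≤ R} := by
  obtain ⟨c, hc, hcS⟩ := exists_pos_le_of_isCompact (isCompact_sphere (0 : Fin n → ℝ) 1) hρ.cont
    fun x hx => hρ.pos x (ne_zero_of_mem_unit_sphere ⟨x, hx⟩)
  have hsub : {x | ρ x ≤ c / 2} ⊆ Metric.closedBall 0 1 := by
    intro x hx
    by_contra hnot
    have hx1 : 1 < ‖x‖ := by simpa using hnot
    obtain ⟨t, ht, htx⟩ := intermediate_value_Icc (zero_le_one (α := ℝ))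
      (continuous_dil_left (w := w) x).norm.continuousOn
      (show (1 : ℝ) ∈ Set.Icc _ _ by simpa [dil_zero_left hw, dil_one] using hx1.le)
    have h1 := hcS _ (mem_sphere_zero_iff_norm.2 htx)
    rw [hρ.homog, abs_of_nonneg ht.1] at h1
    have hx' : ρ x ≤ c / 2 := hx
    nlinarith [mul_le_mul_of_nonneg_right ht.2 (hρ.nonneg x)]
  have hcomp : IsCompact {x | ρ x ≤ c / 2} :=
    (isCompact_closedBall _ _).of_isClosed_subset (isClosed_le hρ.cont continuous_const) hsub
  have ht : c / 2 / R ≠ 0 := by positivity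
  convert! hcomp.image (contDiff_dil (k := 0) (w := w) (c / 2 / R)⁻¹).continuous using 1
  ext x
  constructor
  · intro hx
    refine ⟨dil w (c / 2 / R) x, ?_, dil_inv_dil ht x⟩
    have hx' : ρ x ≤ R := hx
    rw [Set.mem_ofPred_eq, hρ.homog, abs_of_pos (by positivity)]
    calc c / 2 / R * ρ x ≤ c / 2 / R * R := by gcongr
      _ = c / 2 := by field_simp
  · rintro ⟨z, hz, rfl⟩
    have hz' : ρ z ≤ c / 2 := hz
    rw [Set.mem_ofPred_eq, hρ.homog, abs_of_pos (by positivity)]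
    calc (c / 2 / R)⁻¹ * ρ z ≤ (c / 2 / R)⁻¹ * (c / 2) := by gcongr
      _ = R := by field_simp

end Dilations

section Derivatives

variable {n : ℕ} {w : Fin n → ℕ}

/-- A function which is `O(t^N)` along `t ↦ t^a e_j`, with `a < N`, has zero `j`-th partial
derivative at the origin. -/
lemma hasFDerivAt_single_eq_zero {f : (Fin n → ℝ) → ℝ} {f' : (Fin n → ℝ) →L[ℝ] ℝ}
    (hf : HasFDerivAt f f' 0) (hf0 : f 0 = 0) {j : Fin n} {a N : ℕ} (ha : 0 < a) (haN : a < N)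
    {C : ℝ} (hb : ∀ᶠ t in 𝓝[>] (0 : ℝ), |f (Pi.single j (t ^ a))| ≤ C * t ^ N) :
    f' (Pi.single j 1) = 0 := by
  have hline : HasDerivAt (fun s : ℝ => f (s • Pi.single j (1 : ℝ)))
      (f' (Pi.single j 1)) 0 := by
    have h1 : HasDerivAt (fun s : ℝ => s • (Pi.single j (1 : ℝ) : Fin n → ℝ))
        (Pi.single j 1) 0 := by
      simpa using (hasDerivAt_id (0 : ℝ)).smul_const (Pi.single j (1 : ℝ) : Fin n → ℝ)
    exact HasFDerivAt.comp_hasDerivAt (0 : ℝ) (by simpa using hf) h1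
  have hpow : Tendsto (fun t : ℝ => t ^ a) (𝓝[>] 0) (𝓝[≠] 0) := by
    refine tendsto_nhdsWithin_iff.2 ⟨?_, ?_⟩
    · have : Tendsto (fun t : ℝ => t ^ a) (𝓝 0) (𝓝 0) := by
        simpa [ha.ne'] using (continuous_pow (M := ℝ) a).tendsto 0
      exact this.mono_left nhdsWithin_le_nhds
    · filter_upwards [self_mem_nhdsWithin] with t ht
      exact pow_ne_zero _ (ne_of_gt ht)
  have hlim := (hasDerivAt_iff_tendsto_slope.1 hline).comp hpow
  refine tendsto_nhds_unique hlim ?_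
  have hz : Tendsto (fun t : ℝ => C * t ^ (N - a)) (𝓝[>] 0) (𝓝 0) := by
    have : Tendsto (fun t : ℝ => C * t ^ (N - a)) (𝓝 0) (𝓝 0) := by
      have h := (continuous_const.mul (continuous_pow (M := ℝ) (N - a))).tendsto (0 : ℝ)
        (f := fun t : ℝ => C * t ^ (N - a))
      simpa [(Nat.sub_pos_of_lt haN).ne'] using h
    exact this.mono_left nhdsWithin_le_nhds
  refine squeeze_zero_norm' ?_ hz
  filter_upwards [hb, self_mem_nhdsWithin] with t ht htpos
  have htpos : 0 < t := htpos
  have hs : (t ^ a) • (Pi.single j (1 : ℝ) : Fin n → ℝ) = Pi.single j (t ^ a) := by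
    rw [← Pi.single_smul]; simp
  simp only [Function.comp_apply, slope_def_field, zero_smul, hf0, sub_zero, hs, norm_div,
    Real.norm_eq_abs]
  rw [abs_of_pos (pow_pos htpos a), div_le_iff₀ (pow_pos htpos a), mul_assoc, ← pow_add,
    Nat.sub_add_cancel haN.le]
  exact ht

lemma WHomog.hasFDerivAt_single_eq_zero (hw : IsWeight w) {f : (Fin n → ℝ) → (Fin n → ℝ)}
    (hf : WHomog w f) {f' : (Fin n → ℝ) →L[ℝ] (Fin n → ℝ)} (hf' : HasFDerivAt f f' 0)
    {j k : Fin n} (hjk : w j < w k) : f' (Pi.single j 1) k = 0 := by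
  refine Carnot.hasFDerivAt_single_eq_zero (f := fun x => f x k)
    (f' := (ContinuousLinearMap.proj k).comp f') (hasFDerivAt_pi'.1 hf' k)
    (by simp [hf.map_zero hw]) (hw.pos j) hjk (C := |f (Pi.single j 1) k|) ?_
  filter_upwards [self_mem_nhdsWithin] with t ht
  rw [← dil_single, hf, dil, abs_mul, abs_of_pos (pow_pos ht _), mul_comm]

lemma IsOw.hasFDerivAt_single_eq_zero (hw : IsWeight w) {ρ : (Fin n → ℝ) → ℝ}
    (hρ : IsPseudoNorm w ρ) {Θ : (Fin n → ℝ) → (Fin n → ℝ)} {m : ℕ} (hΘ : IsOw w ρ Θ m)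
    (hΘ0 : Θ 0 = 0) {Θ' : (Fin n → ℝ) →L[ℝ] (Fin n → ℝ)} (hΘ' : HasFDerivAt Θ Θ' 0)
    {j k : Fin n} (hjk : w j < w k + m) : Θ' (Pi.single j 1) k = 0 := by
  obtain ⟨C, hC⟩ := hΘ k
  refine Carnot.hasFDerivAt_single_eq_zero (f := fun x => Θ x k)
    (f' := (ContinuousLinearMap.proj k).comp Θ') (hasFDerivAt_pi'.1 hΘ' k)
    (by simp [hΘ0]) (hw.pos j) hjk (C := C * ρ (Pi.single j 1) ^ (w k + m)) ?_
  filter_upwards [self_mem_nhdsWithin,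
    ((tendsto_dil_zero hw (Pi.single j 1)).eventually hC).filter_mono nhdsWithin_le_nhds]
    with t ht hb
  rw [hρ.homog, abs_of_pos (show 0 < t from ht), dil_single, ← Nat.cast_add, zpow_natCast, mul_pow] at hb
  linarith

end Derivatives

section Inverse

variable {n : ℕ} {w : Fin n → ℕ}

lemma IsPolyMap.contDiff {f : (Fin n → ℝ) → (Fin n → ℝ)} (hf : IsPolyMap f)
    {k : WithTop ℕ∞} : ContDiff ℝ k f := by
  rw [contDiff_pi]
  intro i
  obtain ⟨p, hp⟩ := hf i
  simp only [hp]
  clear hp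
  induction p using MvPolynomial.induction_on with
  | C a => simpa using contDiff_const
  | add p q hp hq => simpa using hp.add hq
  | mul_X p j hp => simpa using hp.mul (contDiff_apply ℝ ℝ j)

/-- Block triangular matrices with the same diagonal blocks have the same determinant. -/
lemma det_eq_of_blockTriangular {A B : Matrix (Fin n) (Fin n) ℝ} (hA : A.BlockTriangular w)
    (hB : B.BlockTriangular w) (hAB : ∀ i j, w i = w j → A i j = B i j) : A.det = B.det := by
  rw [hA.det, hB.det]
  refine Finset.prod_congr rfl fun a _ => ?_
  congr 1
  ext ⟨i, hi⟩ ⟨j, hj⟩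
  exact hAB i j (hi.trans hj.symm)

/-- A `w`-homogeneous map which is tangent to `φ` up to `O_w(‖x‖^{w+m})`, `m ≥ 1`, has an
invertible differential at the origin if `φ` does. -/
lemma det_fderiv_ne_zero_of_isOw (hw : IsWeight w) {ρ : (Fin n → ℝ) → ℝ}
    (hρ : IsPseudoNorm w ρ) {φ f : (Fin n → ℝ) → (Fin n → ℝ)} (hφ0 : φ 0 = 0)
    {A B : (Fin n → ℝ) →L[ℝ] (Fin n → ℝ)} (hA : HasFDerivAt φ A 0) (hB : HasFDerivAt f B 0)
    (hf : WHomog w f) {m : ℕ} (hm : 1 ≤ m) (hφf : IsOw w ρ (fun x => φ x - f x) m)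
    (hdet : A.det ≠ 0) : B.det ≠ 0 := by
  have hdiff : ∀ i j, w j ≤ w i → A (Pi.single j 1) i = B (Pi.single j 1) i := by
    intro i j hij
    have := hφf.hasFDerivAt_single_eq_zero hw hρ (by simp [hφ0, hf.map_zero hw]) (hA.sub hB)
      (j := j) (k := i) (by omega)
    simpa [sub_eq_zero] using this
  have hBz : ∀ i j, w j < w i → B (Pi.single j 1) i = 0 := fun i j h =>
    hf.hasFDerivAt_single_eq_zero hw hB h
  have key : (LinearMap.toMatrix' (A : (Fin n → ℝ) →ₗ[ℝ] (Fin n → ℝ))).det =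
      (LinearMap.toMatrix' (B : (Fin n → ℝ) →ₗ[ℝ] (Fin n → ℝ))).det := by
    refine det_eq_of_blockTriangular (w := w) ?_ ?_ ?_
    · intro i j h
      exact (hdiff i j h.le).trans (hBz i j h)
    · intro i j h
      exact hBz i j h
    · intro i j h
      exact hdiff i j h.ge
  rw [LinearMap.det_toMatrix', LinearMap.det_toMatrix'] at key
  exact fun h => hdet (key.trans h)

/-- A `w`-homogeneous map which is locally invertible at the origin is bijective. -/
lemma WHomog.bijective (hw : IsWeight w) {f : (Fin n → ℝ) → (Fin n → ℝ)} (hf : WHomog w f)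
    {B : (Fin n → ℝ) ≃L[ℝ] (Fin n → ℝ)}
    (hB : HasStrictFDerivAt f (B : (Fin n → ℝ) →L[ℝ] (Fin n → ℝ)) 0) :
    Function.Bijective f := by
  have hl := hB.eventually_left_inverse
  have hr := hB.eventually_right_inverse
  rw [hf.map_zero hw] at hr
  constructor
  · intro x y hxy
    obtain ⟨t, ⟨ht, htx⟩, -, hty⟩ :=
      ((eventually_ne_dil hw x hl).and (eventually_ne_dil hw y hl)).exists
    rw [hf, hxy, ← hf, hty] at htx
    rw [← dil_inv_dil (w := w) ht x, ← htx, dil_inv_dil ht]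
  · intro y
    obtain ⟨t, ht, hty⟩ := (eventually_ne_dil hw y hr).exists
    exact ⟨dil w t⁻¹ (hB.localInverse f B 0 (dil w t y)), by rw [hf, hty, dil_inv_dil ht]⟩

lemma WHomog.of_inverse {f g : (Fin n → ℝ) → (Fin n → ℝ)} (hf : WHomog w f)
    (hl : Function.LeftInverse g f) (hr : Function.RightInverse g f) : WHomog w g := by
  intro t y
  rw [← hl (dil w t (g y)), hf, hr y]

lemma WHomog.contDiff_of_contDiffAt_zero (hw : IsWeight w) {g : (Fin n → ℝ) → (Fin n → ℝ)}
    (hg : WHomog w g) {k : WithTop ℕ∞} (hk : ∀ᶠ z in 𝓝 0, ContDiffAt ℝ k g z) :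
    ContDiff ℝ k g := by
  rw [contDiff_iff_contDiffAt]
  intro y
  obtain ⟨t, ht, hty⟩ := (eventually_ne_dil hw y hk).exists
  have heq : g = fun z => dil w t⁻¹ (g (dil w t z)) := by
    funext z
    rw [hg, dil_inv_dil ht]
  rw [heq]
  exact (contDiff_dil t⁻¹).contDiffAt.comp y (hty.comp y (contDiff_dil t).contDiffAt)

lemma WHomog.contDiff_inverse (hw : IsWeight w) {f g : (Fin n → ℝ) → (Fin n → ℝ)}
    (hf : WHomog w f) (hpoly : IsPolyMap f) {B : (Fin n → ℝ) ≃L[ℝ] (Fin n → ℝ)}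
    (hB : HasFDerivAt f (B : (Fin n → ℝ) →L[ℝ] (Fin n → ℝ)) 0)
    (hl : Function.LeftInverse g f) (hr : Function.RightInverse g f) :
    ContDiff ℝ (⊤ : ℕ∞) g := by
  have hsm : ContDiffAt ℝ (⊤ : WithTop ℕ∞) f 0 := hpoly.contDiff.contDiffAt
  have hloc := hsm.to_localInverse hB (by simp)
  have huniq := (hsm.hasStrictFDerivAt' hB (by simp)).localInverse_unique
    (Eventually.of_forall hl)
  have hg0 : ContDiffAt ℝ (⊤ : WithTop ℕ∞) g (f 0) := hloc.congr_of_eventuallyEq huniq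
  rw [hf.map_zero hw] at hg0
  exact ((hf.of_inverse hl hr).contDiff_of_contDiffAt_zero hw
    (hg0.eventually (by simp))).of_le le_top

/-- If `φ = f + O_w(‖x‖^{w+m})` with `f` a `w`-homogeneous homeomorphism whose inverse `g` is
continuously differentiable, then `x = g (φ x) + O_w(‖φ x‖^{w+m})`. -/
lemma IsOw.exists_bound_inverse (hw : IsWeight w) {ρ : (Fin n → ℝ) → ℝ}
    (hρ : IsPseudoNorm w ρ) {φ f g : (Fin n → ℝ) → (Fin n → ℝ)} (hφ0 : φ 0 = 0)
    (hf : WHomog w f) (hfc : Continuous f) (hl : Function.LeftInverse g f)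
    (hr : Function.RightInverse g f) (hg : ContDiff ℝ 1 g) {m : ℕ} (hm : 1 ≤ m)
    (hφf : IsOw w ρ (fun x => φ x - f x) m) :
    ∃ C : ℝ, 0 ≤ C ∧ ∃ c > 0, ∀ᶠ x in 𝓝 0, ∀ k,
      |x k - g (φ x) k| ≤ C * (ρ (φ x) / c) ^ (w k + m) := by
  have hghom := hf.of_inverse hl hr
  choose C₀ hC₀ using hφf
  obtain ⟨C, hC, hCC⟩ : ∃ C : ℝ, 0 ≤ C ∧ ∀ k, C₀ k ≤ C :=
    ⟨∑ k, |C₀ k|, by positivity, fun k => (le_abs_self _).trans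
      (Finset.single_le_sum (f := fun k => |C₀ k|) (fun _ _ => abs_nonneg _) (Finset.mem_univ k))⟩
  set K : Set (Fin n → ℝ) := {x | ρ x = 1} with hKdef
  have hK : IsCompact K := (hρ.isCompact_sublevel hw one_pos).of_isClosed_subset
    (isClosed_eq hρ.cont continuous_const) fun x hx => le_of_eq hx
  have hfK := hK.image hfc
  have hfK0 : f '' K ⊆ {0}ᶜ := by
    rintro _ ⟨x, hx, rfl⟩ h0
    have hx0 : x = 0 := by
      rw [← hl x, show f x = 0 from h0, hghom.map_zero hw]
    have hx : ρ x = 1 := hx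
    rw [hx0, hρ.map_zero hw] at hx
    exact zero_ne_one hx
  obtain ⟨δ, hδ, hδsub⟩ := hfK.exists_cthickening_subset_open isOpen_compl_singleton hfK0
  have hTc : IsCompact (Metric.cthickening δ (f '' K)) := hfK.cthickening
  obtain ⟨c, hc, hcT⟩ := exists_pos_le_of_isCompact hTc hρ.cont fun z hz => hρ.pos z (hδsub hz)
  obtain ⟨R, hR⟩ := hTc.isBounded.subset_closedBall (0 : Fin n → ℝ)
  obtain ⟨L, hL⟩ := hg.contDiffOn.exists_lipschitzOnWith (s := Metric.closedBall 0 R)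
    (by simp) (convex_closedBall _ _) (isCompact_closedBall _ _)
  refine ⟨L * C, by positivity, c, hc, ?_⟩
  have hsmall : ∀ᶠ x in 𝓝 (0 : Fin n → ℝ), C * ρ x ^ m < δ := by
    have h : Tendsto (fun x => C * ρ x ^ m) (𝓝 0) (𝓝 (C * ρ 0 ^ m)) :=
      (continuous_const.mul (hρ.cont.pow m)).tendsto 0
    rw [hρ.map_zero hw, zero_pow (by omega), mul_zero] at h
    exact h.eventually (gt_mem_nhds hδ)
  filter_upwards [eventually_all.2 hC₀, hsmall] with x hx hxδ k
  by_cases hx0 : x = 0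
  · subst hx0
    simp [hφ0, hghom.map_zero hw, hρ.map_zero hw]
    positivity
  have hrpos : 0 < ρ x := hρ.pos x hx0
  set r := ρ x with hrdef
  set x' := dil w r⁻¹ x with hx'_eq
  have hxx' : dil w r x' = x := dil_dil_inv hrpos.ne' x
  have hx'K : x' ∈ K := by
    rw [hKdef, Set.mem_ofPred_eq, hx'_eq, hρ.homog, abs_of_pos (inv_pos.2 hrpos),
      ← hrdef, inv_mul_cancel₀ hrpos.ne']
  set z := dil w r⁻¹ (φ x) with hzdef
  have hzφ : dil w r z = φ x := dil_dil_inv hrpos.ne' _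
  have hzf : ‖z - f x'‖ ≤ C * r ^ m := by
    rw [pi_norm_le_iff_of_nonneg (by positivity)]
    intro i
    have h1 : (z - f x') i = (r ^ w i)⁻¹ * (φ x i - f x i) := by
      rw [hx'_eq, hzdef, hf]
      simp only [dil, Pi.sub_apply, inv_pow]
      ring
    have h2 := hx i
    rw [← Nat.cast_add, zpow_natCast] at h2
    rw [h1, Real.norm_eq_abs, abs_mul, abs_of_pos (by positivity),
      inv_mul_le_iff₀ (by positivity)]
    calc |φ x i - f x i| ≤ C₀ i * r ^ (w i + m) := h2
      _ ≤ C * r ^ (w i + m) := by gcongr; exact hCC i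
      _ = r ^ w i * (C * r ^ m) := by ring
  have hfx'mem : f x' ∈ Metric.cthickening δ (f '' K) :=
    Metric.self_subset_cthickening _ ⟨x', hx'K, rfl⟩
  have hzmem : z ∈ Metric.cthickening δ (f '' K) :=
    Metric.mem_cthickening_of_dist_le z (f x') δ _ ⟨x', hx'K, rfl⟩
      (by rw [dist_eq_norm]; exact hzf.trans hxδ.le)
  have hρφ : r ≤ ρ (φ x) / c := by
    rw [le_div_iff₀ hc, ← hzφ, hρ.homog, abs_of_pos hrpos]
    exact mul_le_mul_of_nonneg_left (hcT z hzmem) hrpos.le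
  have hlip : ‖x' - g z‖ ≤ L * (C * r ^ m) := by
    have h := hL.dist_le_mul _ (hR hfx'mem) _ (hR hzmem)
    rw [hl x', dist_eq_norm, dist_eq_norm, norm_sub_rev (f x')] at h
    exact h.trans (by gcongr)
  have hk : x k - g (φ x) k = r ^ w k * (x' - g z) k := by
    have h1 : g (φ x) = dil w r (g z) := by rw [← hzφ, hghom]
    rw [h1]
    conv_lhs => rw [← hxx']
    simp only [dil, Pi.sub_apply]
    ring
  rw [hk, abs_mul, abs_of_pos (by positivity)]
  calc r ^ w k * |(x' - g z) k| ≤ r ^ w k * (L * (C * r ^ m)) := by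
        gcongr; exact (norm_le_pi_norm (x' - g z) k).trans hlip
    _ = L * C * r ^ (w k + m) := by ring
    _ ≤ L * C * (ρ (φ x) / c) ^ (w k + m) := by gcongr

/-- The differential of a map with a differentiable local left inverse has nonzero determinant. -/
lemma det_ne_zero_of_eventually_leftInverse {φ ψ : (Fin n → ℝ) → (Fin n → ℝ)} {x : Fin n → ℝ}
    {A A' : (Fin n → ℝ) →L[ℝ] (Fin n → ℝ)} (hA : HasFDerivAt φ A x)
    (hA' : HasFDerivAt ψ A' (φ x)) (hinv : ∀ᶠ y in 𝓝 x, ψ (φ y) = y) : A.det ≠ 0 := by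
  have h1 : HasFDerivAt (fun y => ψ (φ y)) (A'.comp A) x := hA'.comp x hA
  have h2 : A'.comp A = ContinuousLinearMap.id ℝ (Fin n → ℝ) :=
    h1.unique ((hasFDerivAt_id x).congr_of_eventuallyEq hinv)
  intro h0
  have h3 : LinearMap.det ((A' : (Fin n → ℝ) →ₗ[ℝ] (Fin n → ℝ)) ∘ₗ
      (A : (Fin n → ℝ) →ₗ[ℝ] (Fin n → ℝ))) = 1 := by
    rw [← ContinuousLinearMap.toLinearMap_comp, h2, ContinuousLinearMap.coe_id,
      LinearMap.det_id]
  rw [LinearMap.det_comp, show LinearMap.det (A : (Fin n → ℝ) →ₗ[ℝ] (Fin n → ℝ)) = 0 from h0,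
    mul_zero] at h3
  exact zero_ne_one h3

end Inverse

/-- If a diffeomorphism `φ` agrees with a `w`-homogeneous polynomial
map `φ̂` up to `O_w(‖x‖^{w+m})`, then `φ̂` is a diffeomorphism of `ℝⁿ` and
`φ⁻¹ = φ̂⁻¹ + O_w(‖x‖^{w+m})` near `0`. -/
theorem inverse_Ow
    {n : ℕ} (hn : 0 < n) {w : Fin n → ℕ} (hw : IsWeight w)
    {U₁ U₂ : Set (Fin n → ℝ)} (hU₁ : IsOpen U₁) (hU₂ : IsOpen U₂)
    (h01 : (0 : Fin n → ℝ) ∈ U₁) (h02 : (0 : Fin n → ℝ) ∈ U₂)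
    {φ ψ : (Fin n → ℝ) → (Fin n → ℝ)}
    (hφ : ContDiffOn ℝ (⊤ : ℕ∞) φ U₁) (hψ : ContDiffOn ℝ (⊤ : ℕ∞) ψ U₂)
    (hmaps : Set.MapsTo φ U₁ U₂) (hmaps' : Set.MapsTo ψ U₂ U₁)
    (himg : φ '' U₁ = U₂)
    (hinv : ∀ x ∈ U₁, ψ (φ x) = x) (hinv' : ∀ y ∈ U₂, φ (ψ y) = y)
    (hφ0 : φ 0 = 0)
    {ρ : (Fin n → ℝ) → ℝ} (hρ : IsPseudoNorm w ρ)
    {m : ℕ} (hm : 1 ≤ m)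
    {φh : (Fin n → ℝ) → (Fin n → ℝ)}
    (hpoly : IsPolyMap φh) (hhom : WHomog w φh)
    (happrox : IsOw w ρ (fun x => φ x - φh x) m) :
    Function.Bijective φh ∧
    ∃ χ : (Fin n → ℝ) → (Fin n → ℝ),
      ContDiff ℝ (⊤ : ℕ∞) χ ∧
      Function.LeftInverse χ φh ∧ Function.RightInverse χ φh ∧
      IsOw w ρ (fun x => ψ x - χ x) m := by
  have hA : HasFDerivAt φ (fderiv ℝ φ 0) 0 :=
    ((hφ.contDiffAt (hU₁.mem_nhds h01)).differentiableAt (by simp)).hasFDerivAt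
  have hA' : HasFDerivAt ψ (fderiv ℝ ψ 0) 0 :=
    ((hψ.contDiffAt (hU₂.mem_nhds h02)).differentiableAt (by simp)).hasFDerivAt
  have hB : HasFDerivAt φh (fderiv ℝ φh 0) 0 :=
    (hpoly.contDiff (k := 1)).differentiable (by simp) 0 |>.hasFDerivAt
  have hAdet := det_ne_zero_of_eventually_leftInverse hA (hφ0.symm ▸ hA')
    (eventually_of_mem (hU₁.mem_nhds h01) hinv)
  have hBdet := det_fderiv_ne_zero_of_isOw hw hρ hφ0 hA hB hhom hm happrox hAdet
  rw [← (fderiv ℝ φh 0).coe_toContinuousLinearEquivOfDetNeZero hBdet] at hB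
  have hbij := hhom.bijective hw
    ((hpoly.contDiff (k := 1)).contDiffAt.hasStrictFDerivAt' hB (by simp))
  set e := Equiv.ofBijective φh hbij
  have hl : Function.LeftInverse e.symm φh := e.left_inv
  have hr : Function.RightInverse e.symm φh := e.right_inv
  have hsmooth : ContDiff ℝ (⊤ : ℕ∞) e.symm := hhom.contDiff_inverse hw hpoly hB hl hr
  refine ⟨hbij, e.symm, hsmooth, hl, hr, fun k => ?_⟩
  obtain ⟨C, hC, c, hc, hb⟩ := happrox.exists_bound_inverse hw hρ hφ0 hhom
    (hpoly.contDiff (k := 0)).continuous hl hr (hsmooth.of_le (by exact_mod_cast le_top)) hm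
  have hψ0 : Tendsto ψ (𝓝 0) (𝓝 0) := by
    have h := hA'.continuousAt.tendsto
    have h0 : ψ 0 = 0 := by simpa [hφ0] using hinv 0 h01
    rwa [h0] at h
  refine ⟨C / c ^ (w k + m), ?_⟩
  filter_upwards [hψ0.eventually hb, hU₂.mem_nhds h02] with y hy hyU
  have h := hy k
  rw [hinv' y hyU, div_pow] at h
  rw [← Nat.cast_add, zpow_natCast]
  calc |(ψ y - e.symm y) k| ≤ C * (ρ y ^ (w k + m) / c ^ (w k + m)) := h
    _ = C / c ^ (w k + m) * ρ y ^ (w k + m) := by ring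

end Carnot
end
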